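/- arXiv:0911.0257 — 2 statements merged into one kernel-verified Lean document; each statement's English description precedes it below -/
import Mathlib

section
/- If in addition the maps ηᵢ(t) := t·sᵢ(t) are strictly convex on [0,1], then the minimizer c* of c ↦ W_p^p(μ, Σᵢ cᵢ δ_{xᵢ}) + Σᵢ cᵢ sᵢ(cᵢ) over the unit simplex is unique. -/
open MeasureTheory

/-- `W_p^p(μ, Σᵢ cᵢ δ_{xᵢ})` as a function of the weights `c`. -/
noncomputable def WppAtomic {n k : ℕ} (μ : Measure (EuclideanSpace ℝ (Fin n)))
    (p : ℝ) (x : Fin k → EuclideanSpace ℝ (Fin n)) (c : Fin k → ℝ) : ℝ :=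
  (sInf {I : ENNReal | ∃ γ : Measure (EuclideanSpace ℝ (Fin n) × EuclideanSpace ℝ (Fin n)),
      γ.map Prod.fst = μ ∧
      γ.map Prod.snd = ∑ i : Fin k, ENNReal.ofReal (c i) • Measure.dirac (x i) ∧
      I = ∫⁻ q, ENNReal.ofReal (dist q.1 q.2 ^ p) ∂γ}).toReal

section MinimizerUniqueness

variable {n k : ℕ}

/-- The transport costs of all couplings of `μ` with `Σᵢ cᵢ δ_{xᵢ}`. -/
def atomicCosts (μ : Measure (EuclideanSpace ℝ (Fin n))) (p : ℝ)
    (x : Fin k → EuclideanSpace ℝ (Fin n)) (c : Fin k → ℝ) : Set ENNReal :=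
  {I : ENNReal | ∃ γ : Measure (EuclideanSpace ℝ (Fin n) × EuclideanSpace ℝ (Fin n)),
      γ.map Prod.fst = μ ∧
      γ.map Prod.snd = ∑ i : Fin k, ENNReal.ofReal (c i) • Measure.dirac (x i) ∧
      I = ∫⁻ q, ENNReal.ofReal (dist q.1 q.2 ^ p) ∂γ}

lemma sInf_atomicCosts_ne_top {Ω : Set (EuclideanSpace ℝ (Fin n))} (hΩ : IsCompact Ω)
    {p : ℝ} (hp : 0 ≤ p) {μ : Measure (EuclideanSpace ℝ (Fin n))} [IsProbabilityMeasure μ]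
    (hμΩ : μ Ω = 1) {x : Fin k → EuclideanSpace ℝ (Fin n)} (hx : ∀ i, x i ∈ Ω)
    {c : Fin k → ℝ} (hc : c ∈ stdSimplex ℝ (Fin k)) :
    sInf (atomicCosts μ p x c) ≠ ⊤ := by
  set ν : Measure (EuclideanSpace ℝ (Fin n)) :=
    ∑ i : Fin k, ENNReal.ofReal (c i) • Measure.dirac (x i) with hν
  have : IsProbabilityMeasure ν := by
    constructor
    simp only [hν, Measure.coe_finsetSum, Finset.sum_apply, Measure.smul_apply, measure_univ,
      smul_eq_mul, mul_one]
    rw [← ENNReal.ofReal_sum_of_nonneg fun i _ => hc.1 i, hc.2, ENNReal.ofReal_one]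
  have hμ : ∀ᵐ y ∂μ, y ∈ Ω := (mem_ae_iff_prob_eq_one hΩ.measurableSet).2 hμΩ
  have hνΩ : ∀ᵐ z ∂ν, z ∈ Ω := by
    rw [ae_iff]
    change ν Ωᶜ = 0
    simp only [hν, Measure.coe_finsetSum, Finset.sum_apply, Measure.smul_apply, smul_eq_mul]
    refine Finset.sum_eq_zero fun i _ => ?_
    rw [Measure.dirac_apply' _ hΩ.measurableSet.compl,
      Set.indicator_of_notMem (by simpa using hx i), mul_zero]
  have hprod : ∀ᵐ q ∂μ.prod ν, q.1 ∈ Ω ∧ q.2 ∈ Ω :=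
    (Measure.quasiMeasurePreserving_fst.ae hμ).and (Measure.quasiMeasurePreserving_snd.ae hνΩ)
  have hbound : ∫⁻ q, ENNReal.ofReal (dist q.1 q.2 ^ p) ∂μ.prod ν ≤
      ∫⁻ _, ENNReal.ofReal (Metric.diam Ω ^ p) ∂μ.prod ν := by
    refine lintegral_mono_ae ?_
    filter_upwards [hprod] with q hq
    have := Metric.dist_le_diam_of_mem hΩ.isBounded hq.1 hq.2
    gcongr
  have hmem : ∫⁻ q, ENNReal.ofReal (dist q.1 q.2 ^ p) ∂μ.prod ν ∈ atomicCosts μ p x c :=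
    ⟨μ.prod ν, by simp [Measure.map_fst_prod], by simp [Measure.map_snd_prod, hν], rfl⟩
  exact ne_top_of_le_ne_top (by simp) ((sInf_le hmem).trans hbound)

lemma sInf_atomicCosts_combo_le (μ : Measure (EuclideanSpace ℝ (Fin n))) (p : ℝ)
    (x : Fin k → EuclideanSpace ℝ (Fin n)) {c c' : Fin k → ℝ} (hc : ∀ i, 0 ≤ c i)
    (hc' : ∀ i, 0 ≤ c' i) {a b : ℝ} (ha : 0 < a) (hb : 0 < b) (hab : a + b = 1) :
    sInf (atomicCosts μ p x (a • c + b • c')) ≤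
      ENNReal.ofReal a * sInf (atomicCosts μ p x c) +
        ENNReal.ofReal b * sInf (atomicCosts μ p x c') := by
  rw [sInf_eq_iInf' (atomicCosts μ p x c), sInf_eq_iInf' (atomicCosts μ p x c'),
    ENNReal.mul_iInf_of_ne (by simpa using ha) ENNReal.ofReal_ne_top,
    ENNReal.mul_iInf_of_ne (by simpa using hb) ENNReal.ofReal_ne_top, ENNReal.iInf_add]
  refine le_iInf ?_
  rintro ⟨_, γ, h₁, h₂, rfl⟩
  rw [ENNReal.add_iInf]
  refine le_iInf ?_
  rintro ⟨_, γ', h₁', h₂', rfl⟩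
  refine sInf_le ⟨ENNReal.ofReal a • γ + ENNReal.ofReal b • γ', ?_, ?_, ?_⟩
  · rw [Measure.map_add _ _ measurable_fst, Measure.map_smul, Measure.map_smul, h₁, h₁',
      ← add_smul, ← ENNReal.ofReal_add ha.le hb.le, hab, ENNReal.ofReal_one, one_smul]
  · rw [Measure.map_add _ _ measurable_snd, Measure.map_smul, Measure.map_smul, h₂, h₂',
      Finset.smul_sum, Finset.smul_sum, ← Finset.sum_add_distrib]
    refine Finset.sum_congr rfl fun i _ => ?_
    rw [smul_smul, smul_smul, ← add_smul, ← ENNReal.ofReal_mul ha.le, ← ENNReal.ofReal_mul hb.le,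
      ← ENNReal.ofReal_add (mul_nonneg ha.le (hc i)) (mul_nonneg hb.le (hc' i))]
    simp
  · rw [lintegral_add_measure, lintegral_smul_measure, lintegral_smul_measure, smul_eq_mul,
      smul_eq_mul]

lemma convexOn_WppAtomic {Ω : Set (EuclideanSpace ℝ (Fin n))} (hΩ : IsCompact Ω)
    {p : ℝ} (hp : 0 ≤ p) {μ : Measure (EuclideanSpace ℝ (Fin n))} [IsProbabilityMeasure μ]
    (hμΩ : μ Ω = 1) {x : Fin k → EuclideanSpace ℝ (Fin n)} (hx : ∀ i, x i ∈ Ω) :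
    ConvexOn ℝ (stdSimplex ℝ (Fin k)) (WppAtomic μ p x) := by
  refine convexOn_iff_forall_pos.2 ⟨convex_stdSimplex ℝ _, fun c hc c' hc' a b ha hb hab => ?_⟩
  have htop := ENNReal.mul_ne_top (ENNReal.ofReal_ne_top (r := a))
    (sInf_atomicCosts_ne_top hΩ hp hμΩ hx hc)
  have htop' := ENNReal.mul_ne_top (ENNReal.ofReal_ne_top (r := b))
    (sInf_atomicCosts_ne_top hΩ hp hμΩ hx hc')
  have h := ENNReal.toReal_mono (ENNReal.add_ne_top.2 ⟨htop, htop'⟩)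
    (sInf_atomicCosts_combo_le μ p x hc.1 hc'.1 ha hb hab)
  rwa [ENNReal.toReal_add htop htop', ENNReal.toReal_mul, ENNReal.toReal_mul,
    ENNReal.toReal_ofReal ha.le, ENNReal.toReal_ofReal hb.le] at h

lemma strictConvexOn_sum_stdSimplex {ι : Type*} [Fintype ι] {η : ι → ℝ → ℝ}
    (hη : ∀ i, StrictConvexOn ℝ (Set.Icc (0 : ℝ) 1) (η i)) :
    StrictConvexOn ℝ (stdSimplex ℝ ι) (fun c => ∑ i, η i (c i)) := by
  refine ⟨convex_stdSimplex ℝ _, fun c hc c' hc' hne a b ha hb hab => ?_⟩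
  simp only [Finset.smul_sum, ← Finset.sum_add_distrib]
  obtain ⟨j, hj⟩ := Function.ne_iff.1 hne
  exact Finset.sum_lt_sum
    (fun i _ => (hη i).convexOn.2 (mem_Icc_of_mem_stdSimplex hc i)
      (mem_Icc_of_mem_stdSimplex hc' i) ha.le hb.le hab)
    ⟨j, Finset.mem_univ j, (hη j).2 (mem_Icc_of_mem_stdSimplex hc j)
      (mem_Icc_of_mem_stdSimplex hc' j) hj ha hb hab⟩

end MinimizerUniqueness

/-- If each `t ↦ t · sᵢ(t)` is strictly convex on `[0,1]`, the minimizer of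
`c ↦ W_p^p(μ, Σ cᵢ δ_{xᵢ}) + Σ cᵢ sᵢ(cᵢ)` over the unit simplex is unique. -/
theorem minimizer_simplex_unique
    {n k : ℕ} (Ω : Set (EuclideanSpace ℝ (Fin n))) (hΩ : IsCompact Ω)
    (p : ℝ) (hp : 1 < p)
    (μ : Measure (EuclideanSpace ℝ (Fin n))) [IsProbabilityMeasure μ]
    (hac : μ ≪ volume) (hμΩ : μ Ω = 1)
    (x : Fin k → EuclideanSpace ℝ (Fin n)) (hx : ∀ i, x i ∈ Ω)
    (s : Fin k → ℝ → ℝ)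
    (hscont : ∀ i, ContinuousOn (s i) (Set.Icc 0 1))
    (hsconv : ∀ i, StrictConvexOn ℝ (Set.Icc (0:ℝ) 1) (fun t => t * s i t))
    (c c' : Fin k → ℝ) (hc : c ∈ stdSimplex ℝ (Fin k)) (hc' : c' ∈ stdSimplex ℝ (Fin k))
    (hmin : ∀ d ∈ stdSimplex ℝ (Fin k),
      WppAtomic μ p x c + ∑ i, c i * s i (c i) ≤
        WppAtomic μ p x d + ∑ i, d i * s i (d i))
    (hmin' : ∀ d ∈ stdSimplex ℝ (Fin k),
      WppAtomic μ p x c' + ∑ i, c' i * s i (c' i) ≤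
        WppAtomic μ p x d + ∑ i, d i * s i (d i)) :
    c = c' := by
  exact ((convexOn_WppAtomic hΩ (zero_le_one.trans hp.le) hμΩ hx).add_strictConvexOn
    (strictConvexOn_sum_stdSimplex hsconv)).eq_of_isMinOn hmin hmin' hc hc'
end

section
/- Let μ be an absolutely continuous probability measure on a compact Ω ⊂ ℝⁿ and ν = Σᵢ₌₁ᵏ bᵢ δ_{yᵢ} an atomic probability measure with distinct points yᵢ. Then for p > 1 there exists an optimal transport map T for the cost |x−y|ᵖ from μ to ν, T is of the form T = Σᵢ yᵢ 1_{Bᵢ} for a measurable partition (Bᵢ) with μ(Bᵢ) = bᵢ, and T is unique μ-a.e. -/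
open MeasureTheory

/-- In a strictly convex space, `‖x‖ ^ p` is strictly convex for `p > 1`. -/
theorem strictConvexOn_norm_rpow {E : Type*} [NormedAddCommGroup E] [NormedSpace ℝ E]
    [StrictConvexSpace ℝ E] {p : ℝ} (hp : 1 < p) :
    StrictConvexOn ℝ Set.univ fun x : E => ‖x‖ ^ p := by
  refine ⟨convex_univ, fun x _ y _ hxy a b ha hb hab => ?_⟩
  have hp0 : 0 < p := by linarith
  simp only [smul_eq_mul]
  by_cases h : ‖x‖ = ‖y‖
  · have h1 : ‖a • x + b • y‖ < ‖y‖ := norm_combo_lt_of_ne h.le le_rfl hxy ha hb hab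
    calc ‖a • x + b • y‖ ^ p < ‖y‖ ^ p := Real.rpow_lt_rpow (norm_nonneg _) h1 hp0
      _ = a * ‖x‖ ^ p + b * ‖y‖ ^ p := by rw [h, ← add_mul, hab, one_mul]
  · have h1 : ‖a • x + b • y‖ ≤ a * ‖x‖ + b * ‖y‖ := by
      refine (norm_add_le _ _).trans_eq ?_
      rw [norm_smul, norm_smul, Real.norm_of_nonneg ha.le, Real.norm_of_nonneg hb.le]
    exact (Real.rpow_le_rpow (norm_nonneg _) h1 hp0.le).trans_lt
      ((strictConvexOn_rpow hp).2 (norm_nonneg x) (norm_nonneg y) h ha hb hab)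

/-- The increments of a strictly convex function are strictly monotone along a line. -/
theorem StrictConvexOn.sub_add_lt_sub_add {E : Type*} [AddCommGroup E] [Module ℝ E] {g : E → ℝ}
    (hg : StrictConvexOn ℝ Set.univ g) {v : E} (hv : v ≠ 0) (x : E) {s : ℝ} (hs : 0 < s) :
    g (x + v) - g x < g (x + s • v + v) - g (x + s • v) := by
  have hs1 : 0 < 1 + s := by linarith
  have hne : x ≠ x + s • v + v := by
    intro h
    have : (1 + s) • v = 0 := by
      rw [add_smul, one_smul]
      have h' : x + (v + s • v) = x + 0 := by rw [add_zero]; nth_rw 2 [h]; abel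
      exact add_left_cancel h'
    exact (smul_ne_zero hs1.ne' hv) this
  have hab : s / (1 + s) + 1 / (1 + s) = 1 := by field_simp; ring
  have hab' : 1 / (1 + s) + s / (1 + s) = 1 := by rw [add_comm, hab]
  have key : ∀ a b : ℝ, a + b = 1 → a • x + b • (x + s • v + v) = x + (b * (1 + s)) • v := by
    intro a b h
    have : a = 1 - b := by linarith
    subst this
    module
  have h1 := hg.2 (Set.mem_univ x) (Set.mem_univ (x + s • v + v)) hne
    (div_pos hs hs1) (one_div_pos.2 hs1) hab
  have h2 := hg.2 (Set.mem_univ x) (Set.mem_univ (x + s • v + v)) hne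
    (one_div_pos.2 hs1) (div_pos hs hs1) hab'
  rw [key _ _ hab, div_mul_cancel₀ _ hs1.ne', one_smul] at h1
  rw [key _ _ hab', div_mul_cancel₀ _ hs1.ne'] at h2
  simp only [smul_eq_mul] at h1 h2
  have h3 : s / (1 + s) * g x + 1 / (1 + s) * g x = g x := by rw [← add_mul, hab, one_mul]
  have h4 : s / (1 + s) * g (x + s • v + v) + 1 / (1 + s) * g (x + s • v + v)
    = g (x + s • v + v) := by rw [← add_mul, hab, one_mul]
  linarith

/-- For `p > 1`, the level sets of `‖x - a‖ ^ p - ‖x - b‖ ^ p` with `a ≠ b` are null: each line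
in the direction `b - a` meets them at most once. -/
theorem addHaar_setOf_norm_sub_rpow_sub_eq {E : Type*} [NormedAddCommGroup E] [NormedSpace ℝ E]
    [StrictConvexSpace ℝ E] [FiniteDimensional ℝ E] [MeasurableSpace E] [BorelSpace E]
    (μ : Measure E) [μ.IsAddHaarMeasure] {p : ℝ} (hp : 1 < p) {a b : E} (hab : a ≠ b) (r : ℝ) :
    μ {x | ‖x - a‖ ^ p - ‖x - b‖ ^ p = r} = 0 := by
  have hcont : Continuous fun x : E => ‖x - a‖ ^ p - ‖x - b‖ ^ p := by
    have : 0 ≤ p := by linarith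
    fun_prop (disch := assumption)
  have hmeas : MeasurableSet {x | ‖x - a‖ ^ p - ‖x - b‖ ^ p = r} :=
    (isClosed_eq hcont continuous_const).measurableSet
  have hmono : ∀ x : E, ∀ s : ℝ, 0 < s → ‖x - a‖ ^ p - ‖x - b‖ ^ p <
      ‖x + s • (b - a) - a‖ ^ p - ‖x + s • (b - a) - b‖ ^ p := by
    intro x s hs
    have h := (strictConvexOn_norm_rpow (E := E) hp).sub_add_lt_sub_add
      (sub_ne_zero.2 hab.symm) (x - b) hs
    have e1 : x - b + (b - a) = x - a := by abel
    have e2 : x - b + s • (b - a) + (b - a) = x + s • (b - a) - a := by abel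
    have e3 : x - b + s • (b - a) = x + s • (b - a) - b := by abel
    rw [e1, e2, e3] at h
    exact h
  refine measure_eq_zero_iff_ae_notMem.2 ?_
  refine ae_mem_of_ae_add_linearMap_mem (LinearMap.toSpanSingleton ℝ E (b - a)) volume μ
    hmeas.compl fun x => ?_
  refine measure_mono_null ?_ (Set.Subsingleton.measure_zero (s := {t : ℝ |
    ‖x + t • (b - a) - a‖ ^ p - ‖x + t • (b - a) - b‖ ^ p = r}) ?_ volume)
  · exact fun t ht => not_not.1 ht
  · have hlt : ∀ s t : ℝ, s < t → ‖x + s • (b - a) - a‖ ^ p - ‖x + s • (b - a) - b‖ ^ p <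
        ‖x + t • (b - a) - a‖ ^ p - ‖x + t • (b - a) - b‖ ^ p := by
      intro s t hst
      have h := hmono (x + s • (b - a)) (t - s) (sub_pos.2 hst)
      have e : x + s • (b - a) + (t - s) • (b - a) = x + t • (b - a) := by module
      rwa [e] at h
    intro s hs t ht
    simp only [Set.mem_ofPred_eq] at hs ht
    rcases lt_trichotomy s t with h | h | h
    · have := hlt _ _ h; linarith
    · exact h
    · have := hlt _ _ h; linarith

section SemiDiscrete

variable {ι X : Type*} [Fintype ι] [Nonempty ι]

/-- The `c`-transform `x ↦ minᵢ (cᵢ(x) - φᵢ)` of a finite family of potentials. -/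
noncomputable def cTransform (c : ι → X → ℝ) (φ : ι → ℝ) (x : X) : ℝ :=
  Finset.univ.inf' Finset.univ_nonempty fun i => c i x - φ i

theorem cTransform_le (c : ι → X → ℝ) (φ : ι → ℝ) (x : X) (i : ι) :
    cTransform c φ x ≤ c i x - φ i :=
  Finset.inf'_le (fun i => c i x - φ i) (Finset.mem_univ i)

theorem le_cTransform_iff {c : ι → X → ℝ} {φ : ι → ℝ} {x : X} {a : ℝ} :
    a ≤ cTransform c φ x ↔ ∀ i, a ≤ c i x - φ i := by
  simp [cTransform, Finset.le_inf'_iff]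

theorem exists_cTransform_eq (c : ι → X → ℝ) (φ : ι → ℝ) (x : X) :
    ∃ i, cTransform c φ x = c i x - φ i := by
  obtain ⟨i, -, hi⟩ := Finset.exists_mem_eq_inf' (Finset.univ_nonempty (α := ι))
    fun i => c i x - φ i
  exact ⟨i, hi⟩

theorem continuous_cTransform (c : ι → X → ℝ) (x : X) :
    Continuous fun φ => cTransform c φ x :=
  Continuous.finset_inf'_apply _ fun i _ => by fun_prop

variable [MeasurableSpace X]

theorem measurable_cTransform {c : ι → X → ℝ} (hc : ∀ i, Measurable (c i)) (φ : ι → ℝ) :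
    Measurable (cTransform c φ) := by
  refine measurable_of_Ici fun a => ?_
  have h : cTransform c φ ⁻¹' Set.Ici a = ⋂ i, {x | a ≤ c i x - φ i} := by
    ext x
    simp only [Set.mem_preimage, Set.mem_Ici, le_cTransform_iff, Set.mem_iInter, Set.mem_ofPred_eq]
  rw [h]
  exact MeasurableSet.iInter fun i => measurableSet_le measurable_const ((hc i).sub_const _)

theorem integrable_cTransform {μ : Measure X} [IsFiniteMeasure μ] {c : ι → X → ℝ}
    (hc : ∀ i, Measurable (c i)) {M : ℝ} (hM : ∀ᵐ x ∂μ, ∀ i, 0 ≤ c i x ∧ c i x ≤ M)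
    (φ : ι → ℝ) : Integrable (cTransform c φ) μ := by
  have hci : ∀ i, Integrable (c i) μ := fun i =>
    Integrable.of_bound (hc i).aestronglyMeasurable M <| by
      filter_upwards [hM] with x hx
      rw [Real.norm_of_nonneg (hx i).1]
      exact (hx i).2
  refine Integrable.mono' (g := fun x => ∑ i, ‖c i x - φ i‖)
    (integrable_finsetSum _ fun i _ => ((hci i).sub (integrable_const _)).norm)
    (measurable_cTransform hc φ).aestronglyMeasurable (Filter.Eventually.of_forall fun x => ?_)
  obtain ⟨i, hi⟩ := exists_cTransform_eq c φ x
  rw [hi]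
  exact Finset.single_le_sum (f := fun i => ‖c i x - φ i‖) (fun _ _ => norm_nonneg _)
    (Finset.mem_univ i)

/-- The semi-discrete Kantorovich dual functional attains its maximum. -/
theorem exists_forall_integral_cTransform_add_sum_le (μ : Measure X) [IsProbabilityMeasure μ]
    {c : ι → X → ℝ} (hc : ∀ i, Measurable (c i)) {M : ℝ}
    (hM : ∀ᵐ x ∂μ, ∀ i, 0 ≤ c i x ∧ c i x ≤ M)
    {b : ι → ℝ} (hb0 : ∀ i, 0 ≤ b i) (hb : ∑ i, b i = 1) :
    ∃ ψ : ι → ℝ, ∀ φ : ι → ℝ,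
      ∫ x, cTransform c φ x ∂μ + ∑ i, b i * φ i ≤
        ∫ x, cTransform c ψ x ∂μ + ∑ i, b i * ψ i := by
  have hM0 : 0 ≤ M := by
    obtain ⟨x, hx⟩ := hM.exists
    obtain ⟨h0, h1⟩ := hx (Classical.arbitrary ι)
    exact h0.trans h1
  set G : (ι → ℝ) → ℝ := fun φ => ∫ x, cTransform c φ x ∂μ + ∑ i, b i * φ i with hG
  have hcont : ContinuousOn G (Set.Icc (fun _ : ι => -M) (0 : ι → ℝ)) := by
    refine ContinuousOn.add ?_ (by fun_prop)
    refine continuousOn_of_dominated (bound := fun _ => 2 * M)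
      (fun φ _ => (measurable_cTransform hc φ).aestronglyMeasurable) (fun φ hφ => ?_)
      (integrable_const _)
      (Filter.Eventually.of_forall fun x => (continuous_cTransform c x).continuousOn)
    filter_upwards [hM] with x hx
    obtain ⟨i, hi⟩ := exists_cTransform_eq c φ x
    have h1 : -M ≤ φ i := hφ.1 i
    have h2 : φ i ≤ 0 := hφ.2 i
    have h3 := hx i
    rw [hi, Real.norm_eq_abs, abs_le]
    constructor <;> linarith
  obtain ⟨ψ, hψ, hmax⟩ := isCompact_Icc.exists_isMaxOn
    (Set.nonempty_Icc.2 fun i => by simpa using hM0) hcont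
  refine ⟨ψ, fun φ => ?_⟩
  obtain ⟨i₀, hi₀⟩ := Finite.exists_max φ
  set φ' : ι → ℝ := fun i => max (φ i - φ i₀) (-M) with hφ'
  have hmem : φ' ∈ Set.Icc (fun _ : ι => -M) (0 : ι → ℝ) :=
    ⟨fun i => le_max_right _ _, fun i => max_le (sub_nonpos.2 (hi₀ i)) (by simpa using hM0)⟩
  refine le_trans ?_ (hmax hmem)
  have h1 : ∫ x, cTransform c φ x ∂μ + φ i₀ ≤ ∫ x, cTransform c φ' x ∂μ := by
    have h_int := integrable_cTransform hc hM φ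
    calc ∫ x, cTransform c φ x ∂μ + φ i₀ = ∫ x, (cTransform c φ x + φ i₀) ∂μ := by
          rw [integral_add h_int (integrable_const _)]
          simp
      _ ≤ ∫ x, cTransform c φ' x ∂μ := by
          refine integral_mono_ae (h_int.add (integrable_const _))
            (integrable_cTransform hc hM φ') ?_
          filter_upwards [hM] with x hx
          refine le_cTransform_iff.2 fun i => ?_
          have h2 := cTransform_le c φ x i
          have h3 := cTransform_le c φ x i₀
          have h4 := hx i
          have h5 := hx i₀
          rcases max_choice (φ i - φ i₀) (-M) with h | h <;> simp only [hφ', h] <;> linarith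
  have h2 : ∑ i, b i * φ i - φ i₀ ≤ ∑ i, b i * φ' i := by
    calc ∑ i, b i * φ i - φ i₀ = ∑ i, b i * (φ i - φ i₀) := by
          simp only [mul_sub, Finset.sum_sub_distrib, ← Finset.sum_mul, hb, one_mul]
      _ ≤ ∑ i, b i * φ' i :=
          Finset.sum_le_sum fun i _ => mul_le_mul_of_nonneg_left (le_max_left _ _) (hb0 i)
  simp only [hG]
  linarith

/-- At a maximizer of the dual functional, every Laguerre cell has at least the prescribed mass. -/
theorem le_measureReal_setOf_eq_cTransform {μ : Measure X} [IsProbabilityMeasure μ]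
    {c : ι → X → ℝ} (hc : ∀ i, Measurable (c i)) {M : ℝ}
    (hM : ∀ᵐ x ∂μ, ∀ i, 0 ≤ c i x ∧ c i x ≤ M) {b : ι → ℝ} {ψ : ι → ℝ}
    (hψ : ∀ φ : ι → ℝ, ∫ x, cTransform c φ x ∂μ + ∑ i, b i * φ i ≤
        ∫ x, cTransform c ψ x ∂μ + ∑ i, b i * ψ i) (i : ι) :
    b i ≤ μ.real {x | c i x - ψ i ≤ cTransform c ψ x} := by
  classical
  have hmeas : ∀ t : ℝ, MeasurableSet {x | c i x - ψ i - t ≤ cTransform c ψ x} := fun t =>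
    measurableSet_le (((hc i).sub_const _).sub_const _) (measurable_cTransform hc ψ)
  have key : ∀ t : ℝ, 0 < t → b i ≤ μ.real {x | c i x - ψ i - t ≤ cTransform c ψ x} := by
    intro t ht
    set A := {x | c i x - ψ i - t ≤ cTransform c ψ x} with hA
    have hpert := hψ (ψ + Pi.single i t)
    have hsum : ∑ j, b j * (ψ + Pi.single i t : ι → ℝ) j = ∑ j, b j * ψ j + b i * t := by
      simp [mul_add, Finset.sum_add_distrib, Pi.single_apply]
    have hle : ∫ x, (cTransform c ψ x - A.indicator (fun _ => t) x) ∂μ ≤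
        ∫ x, cTransform c (ψ + Pi.single i t) x ∂μ := by
      refine integral_mono ((integrable_cTransform hc hM ψ).sub
        ((integrable_const t).indicator (hmeas t))) (integrable_cTransform hc hM _) fun x => ?_
      refine le_cTransform_iff.2 fun j => ?_
      have hj := cTransform_le c ψ x j
      by_cases hx : x ∈ A
      · by_cases hji : j = i
        · subst hji
          simp [hx]
          linarith
        · simp [hx, hji]
          linarith
      · by_cases hji : j = i
        · subst hji
          simp [hx]
          simp [hA] at hx
          linarith
        · simp [hx, hji]
          linarith
    rw [integral_sub (integrable_cTransform hc hM ψ)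
      ((integrable_const t).indicator (hmeas t)), integral_indicator_const _ (hmeas t),
      smul_eq_mul] at hle
    have : b i * t ≤ μ.real A * t := by rw [← hA] at hle; linarith
    exact le_of_mul_le_mul_right this ht
  have hInter : {x | c i x - ψ i ≤ cTransform c ψ x} =
      ⋂ n : ℕ, {x | c i x - ψ i - 1 / ((n : ℝ) + 1) ≤ cTransform c ψ x} := by
    ext x
    simp only [Set.mem_ofPred_eq, Set.mem_iInter]
    refine ⟨fun h n => ?_, fun h => ?_⟩
    · have : 0 < 1 / ((n : ℝ) + 1) := Nat.one_div_pos_of_nat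
      linarith
    · refine le_of_forall_pos_le_add fun ε hε => ?_
      obtain ⟨n, hn⟩ := exists_nat_one_div_lt hε
      linarith [h n]
  have hanti : Antitone fun n : ℕ =>
      {x | c i x - ψ i - 1 / ((n : ℝ) + 1) ≤ cTransform c ψ x} := by
    intro m n hmn x hx
    have : 1 / ((n : ℝ) + 1) ≤ 1 / ((m : ℝ) + 1) := Nat.one_div_le_one_div hmn
    simp only [Set.mem_ofPred_eq] at hx ⊢
    linarith
  have hlim := tendsto_measure_iInter_atTop (μ := μ)
    (fun n : ℕ => (hmeas (1 / ((n : ℝ) + 1))).nullMeasurableSet) hanti ⟨0, measure_ne_top _ _⟩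
  rw [← hInter] at hlim
  exact ge_of_tendsto' ((ENNReal.tendsto_toReal (measure_ne_top _ _)).comp hlim)
    fun n => key _ Nat.one_div_pos_of_nat

/-- Semi-discrete optimal assignment: there are potentials whose Laguerre cells have the prescribed
masses, together with a measurable selection of the (almost everywhere unique) minimizing index. -/
theorem exists_measurable_argmin [LinearOrder ι] [MeasurableSpace ι] [MeasurableSingletonClass ι]
    (μ : Measure X) [IsProbabilityMeasure μ]
    {c : ι → X → ℝ} (hc : ∀ i, Measurable (c i)) {M : ℝ}
    (hM : ∀ᵐ x ∂μ, ∀ i, 0 ≤ c i x ∧ c i x ≤ M)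
    (hnull : ∀ i j, i ≠ j → ∀ r, μ {x | c i x - c j x = r} = 0)
    {b : ι → ℝ} (hb0 : ∀ i, 0 ≤ b i) (hb : ∑ i, b i = 1) :
    ∃ (ψ : ι → ℝ) (τ : X → ι), Measurable τ ∧ (∀ i, μ.real (τ ⁻¹' {i}) = b i) ∧
      (∀ x j, c (τ x) x - ψ (τ x) ≤ c j x - ψ j) ∧
      ∀ᵐ x ∂μ, ∀ j, c j x - ψ j = c (τ x) x - ψ (τ x) → j = τ x := by
  obtain ⟨ψ, hψ⟩ := exists_forall_integral_cTransform_add_sum_le μ hc hM hb0 hb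
  have hex : ∀ x, (Finset.univ.filter fun i => c i x - ψ i ≤ cTransform c ψ x).Nonempty := by
    intro x
    obtain ⟨i, hi⟩ := exists_cTransform_eq c ψ x
    exact ⟨i, by simp [hi]⟩
  set τ : X → ι := fun x => Finset.min' _ (hex x) with hτ
  have hτ1 : ∀ x, c (τ x) x - ψ (τ x) ≤ cTransform c ψ x := fun x => by
    simpa only [Finset.mem_filter_univ] using Finset.min'_mem _ (hex x)
  have hτ2 : ∀ x j, c j x - ψ j ≤ cTransform c ψ x → τ x ≤ j := fun x j hj =>
    Finset.min'_le _ _ (by simpa using hj)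
  have hle : ∀ x j, c (τ x) x - ψ (τ x) ≤ c j x - ψ j := fun x j =>
    (hτ1 x).trans (cTransform_le c ψ x j)
  have hcell : ∀ i, MeasurableSet {x | c i x - ψ i ≤ cTransform c ψ x} := fun i =>
    measurableSet_le ((hc i).sub_const _) (measurable_cTransform hc ψ)
  have hmeas : Measurable τ := by
    refine measurable_to_countable' fun i => ?_
    have h : τ ⁻¹' {i} = {x | c i x - ψ i ≤ cTransform c ψ x} ∩
        ⋂ j, {x | j < i → ¬ c j x - ψ j ≤ cTransform c ψ x} := by
      ext x
      simp only [Set.mem_preimage, Set.mem_singleton_iff, Set.mem_inter_iff, Set.mem_ofPred_eq,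
        Set.mem_iInter]
      refine ⟨?_, fun ⟨h1, h2⟩ => ?_⟩
      · rintro rfl
        exact ⟨hτ1 x, fun j hj h => (hτ2 x j h).not_gt hj⟩
      · exact (hτ2 x i h1).antisymm (not_lt.1 fun h => h2 _ h (hτ1 x))
    rw [h]
    refine (hcell i).inter (MeasurableSet.iInter fun j => ?_)
    by_cases hj : j < i
    · simp only [hj, true_imp_iff]
      exact (hcell j).compl
    · simp [hj]
  have huniq : ∀ᵐ x ∂μ, ∀ j, c j x - ψ j = c (τ x) x - ψ (τ x) → j = τ x := by
    have h : ∀ᵐ x ∂μ, ∀ i j, i ≠ j → c i x - c j x ≠ ψ i - ψ j := by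
      refine ae_all_iff.2 fun i => ae_all_iff.2 fun j => ?_
      by_cases hij : i = j
      · simp [hij]
      · filter_upwards [measure_eq_zero_iff_ae_notMem.1 (hnull i j hij (ψ i - ψ j))] with x hx _
        exact hx
    filter_upwards [h] with x hx j hj
    by_contra hne
    exact hx _ _ hne (by linarith)
  have hge : ∀ i, b i ≤ μ.real (τ ⁻¹' {i}) := by
    intro i
    refine (le_measureReal_setOf_eq_cTransform hc hM hψ i).trans ?_
    refine ENNReal.toReal_mono (measure_ne_top _ _) (measure_mono_ae ?_)
    filter_upwards [huniq] with x hx h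
    exact (hx i ((h.trans (cTransform_le c ψ x _)).antisymm (hle x i))).symm
  have hsum : ∑ i, μ.real (τ ⁻¹' {i}) = 1 := by
    have := sum_measureReal_preimage_singleton (μ := μ) Finset.univ (f := τ)
      fun i _ => hmeas (measurableSet_singleton i)
    simpa using this
  refine ⟨ψ, τ, hmeas, fun i => ?_, hle, huniq⟩
  exact ((Finset.sum_eq_sum_iff_of_le fun i _ => hge i).1 (hb.trans hsum.symm) i
    (Finset.mem_univ i)).symm

end SemiDiscrete

/-- For `p > 1`, an absolutely continuous probability measure `μ` on a compact
`Ω ⊂ ℝⁿ`, and an atomic target `ν = Σᵢ bᵢ δ_{yᵢ}` with distinct atoms, there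
exists an optimal transport map `T` for the cost `|x−y|ᵖ`; it takes the form
`T = Σᵢ yᵢ 1_{Bᵢ}` for a measurable partition `(Bᵢ)` with `μ(Bᵢ) = bᵢ`, and it
is unique `μ`-a.e. -/
theorem exists_unique_optimal_map_to_atomic
    {n k : ℕ} (Ω : Set (EuclideanSpace ℝ (Fin n))) (hΩ : IsCompact Ω)
    (p : ℝ) (hp : 1 < p)
    (μ : Measure (EuclideanSpace ℝ (Fin n))) [IsProbabilityMeasure μ]
    (hac : μ ≪ volume) (hμΩ : μ Ω = 1)
    (y : Fin k → EuclideanSpace ℝ (Fin n)) (hy : ∀ i, y i ∈ Ω)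
    (hyinj : Function.Injective y)
    (b : Fin k → NNReal) (hb : ∑ i, b i = 1)
    (ν : Measure (EuclideanSpace ℝ (Fin n)))
    (hν : ν = ∑ i : Fin k, (b i : ENNReal) • Measure.dirac (y i)) :
    ∃ T : EuclideanSpace ℝ (Fin n) → EuclideanSpace ℝ (Fin n),
      Measurable T ∧ μ.map T = ν ∧
      (∃ B : Fin k → Set (EuclideanSpace ℝ (Fin n)),
        (∀ i, MeasurableSet (B i)) ∧ Pairwise (Function.onFun Disjoint B) ∧
        (⋃ i, B i) = Set.univ ∧ (∀ i, μ (B i) = (b i : ENNReal)) ∧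
        ∀ i, ∀ x ∈ B i, T x = y i) ∧
      (∀ S : EuclideanSpace ℝ (Fin n) → EuclideanSpace ℝ (Fin n),
        Measurable S → μ.map S = ν →
        ∫⁻ x, ENNReal.ofReal (‖x - T x‖ ^ p) ∂μ ≤
          ∫⁻ x, ENNReal.ofReal (‖x - S x‖ ^ p) ∂μ) ∧
      (∀ T' : EuclideanSpace ℝ (Fin n) → EuclideanSpace ℝ (Fin n),
        Measurable T' → μ.map T' = ν →
        (∀ S : EuclideanSpace ℝ (Fin n) → EuclideanSpace ℝ (Fin n),
          Measurable S → μ.map S = ν →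
          ∫⁻ x, ENNReal.ofReal (‖x - T' x‖ ^ p) ∂μ ≤
            ∫⁻ x, ENNReal.ofReal (‖x - S x‖ ^ p) ∂μ) →
        T' =ᵐ[μ] T) := by
  have : Nonempty (Fin k) := by
    by_contra h
    rw [not_nonempty_iff] at h
    simp at hb
  have hp0 : 0 ≤ p := by linarith
  set c : Fin k → EuclideanSpace ℝ (Fin n) → ℝ := fun i x => ‖x - y i‖ ^ p with hc
  have hc0 : ∀ i x, 0 ≤ c i x := fun i x => Real.rpow_nonneg (norm_nonneg _) _
  have hcont : ∀ i, Continuous (c i) := fun i => by fun_prop (disch := assumption)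
  obtain ⟨M, hMΩ⟩ := hΩ.exists_bound_of_continuousOn
    (f := fun x => ∑ i, c i x) (by fun_prop)
  have hM : ∀ᵐ x ∂μ, ∀ i, 0 ≤ c i x ∧ c i x ≤ M := by
    filter_upwards [(mem_ae_iff_prob_eq_one hΩ.measurableSet).2 hμΩ] with x hx i
    exact ⟨hc0 i x, (Finset.single_le_sum (f := fun i => c i x) (fun j _ => hc0 j x)
      (Finset.mem_univ i)).trans ((le_abs_self _).trans (hMΩ x hx))⟩
  obtain ⟨ψ, τ, hτ, hτb, hτle, hτuniq⟩ := exists_measurable_argmin μ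
    (fun i => (hcont i).measurable) hM
    (fun i j hij r => hac (addHaar_setOf_norm_sub_rpow_sub_eq volume hp (hyinj.ne hij) r))
    (b := fun i => (b i : ℝ)) (fun i => (b i).2) (by exact_mod_cast hb)
  have hτμ : ∀ i, μ (τ ⁻¹' {i}) = b i := fun i => by
    rw [← ofReal_measureReal, hτb i, ENNReal.ofReal_coe_nnreal]
  have hT : Measurable fun x => y (τ x) := (measurable_of_countable y).comp hτ
  have hTν : μ.map (fun x => y (τ x)) = ν := by
    have h1 : μ.map τ = ∑ i, (b i : ENNReal) • Measure.dirac i := by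
      rw [← Measure.sum_smul_dirac (μ.map τ), Measure.sum_fintype]
      refine Finset.sum_congr rfl fun i _ => ?_
      rw [Measure.map_apply hτ (measurableSet_singleton i), hτμ]
    have h2 := Measure.map_map (μ := μ) (measurable_of_countable y) hτ
    rw [Function.comp_def] at h2
    rw [← h2, h1, hν, Measure.map_finset_sum (measurable_of_countable y).aemeasurable]
    simp [Measure.map_smul, Measure.map_dirac]
  set Ψ : EuclideanSpace ℝ (Fin n) → ℝ := fun z => ∑ j, ({y j} : Set _).indicator (fun _ => ψ j) z
    with hΨ
  have hΨy : ∀ j, Ψ (y j) = ψ j := by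
    intro j
    simp [hΨ, Set.indicator_apply, hyinj.eq_iff]
  have hΨm : Measurable Ψ := Finset.measurable_fun_sum _ fun j _ =>
    measurable_const.indicator (measurableSet_singleton _)
  have hrange : ∀ S : EuclideanSpace ℝ (Fin n) → EuclideanSpace ℝ (Fin n), Measurable S →
      μ.map S = ν → ∀ᵐ x ∂μ, ∃ j, S x = y j := by
    intro S hS hSν
    refine ae_of_ae_map (p := fun z => ∃ j, z = y j) hS.aemeasurable ?_
    rw [hSν, hν, ae_iff, Measure.finsetSum_apply]
    refine Finset.sum_eq_zero fun j _ => ?_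
    rw [Measure.smul_apply, Measure.dirac_apply]
    simp
  have hcostint : ∀ S : EuclideanSpace ℝ (Fin n) → EuclideanSpace ℝ (Fin n), Measurable S →
      μ.map S = ν → Integrable (fun x => ‖x - S x‖ ^ p) μ := by
    intro S hS hSν
    refine Integrable.of_bound (by fun_prop) M ?_
    filter_upwards [hM, hrange S hS hSν] with x hx ⟨j, hj⟩
    rw [hj, Real.norm_of_nonneg (hc0 j x)]
    exact (hx j).2
  have hΨint : Integrable Ψ ν := by
    have : IsFiniteMeasure ν := by rw [← hTν]; infer_instance
    exact integrable_finsetSum _ fun j _ =>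
      (integrable_const _).indicator (measurableSet_singleton _)
  have hΨSint : ∀ S : EuclideanSpace ℝ (Fin n) → EuclideanSpace ℝ (Fin n), Measurable S →
      μ.map S = ν → Integrable (fun x => Ψ (S x)) μ := by
    intro S hS hSν
    rw [← hSν] at hΨint
    exact hΨint.comp_measurable hS
  have hreduced : ∀ S : EuclideanSpace ℝ (Fin n) → EuclideanSpace ℝ (Fin n), Measurable S →
      μ.map S = ν →
      ∫ x, (‖x - S x‖ ^ p - Ψ (S x)) ∂μ = ∫ x, ‖x - S x‖ ^ p ∂μ - ∫ z, Ψ z ∂ν := by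
    intro S hS hSν
    rw [integral_sub (hcostint S hS hSν) (hΨSint S hS hSν), ← hSν,
      integral_map hS.aemeasurable hΨm.aestronglyMeasurable]
  have hlintegral : ∀ S : EuclideanSpace ℝ (Fin n) → EuclideanSpace ℝ (Fin n), Measurable S →
      μ.map S = ν →
      ∫⁻ x, ENNReal.ofReal (‖x - S x‖ ^ p) ∂μ = ENNReal.ofReal (∫ x, ‖x - S x‖ ^ p ∂μ) :=
    fun S hS hSν => (ofReal_integral_eq_lintegral_ofReal (hcostint S hS hSν)
      (Filter.Eventually.of_forall fun x => Real.rpow_nonneg (norm_nonneg _) _)).symm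
  have hpoint : ∀ S : EuclideanSpace ℝ (Fin n) → EuclideanSpace ℝ (Fin n), Measurable S →
      μ.map S = ν → (fun x => ‖x - y (τ x)‖ ^ p - Ψ (y (τ x))) ≤ᵐ[μ]
        fun x => ‖x - S x‖ ^ p - Ψ (S x) := by
    intro S hS hSν
    filter_upwards [hrange S hS hSν] with x ⟨j, hj⟩
    rw [hj, hΨy, hΨy]
    exact hτle x j
  have hintT := (hcostint _ hT hTν).sub (hΨSint _ hT hTν)
  refine ⟨fun x => y (τ x), hT, hTν, ⟨fun i => τ ⁻¹' {i},
    fun i => hτ (measurableSet_singleton i), ?_, ?_, hτμ, ?_⟩, ?_, ?_⟩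
  · exact fun i j hij => Disjoint.preimage τ (Set.disjoint_singleton.2 hij)
  · ext x
    simp
  · rintro i x rfl
    rfl
  · intro S hS hSν
    rw [hlintegral _ hT hTν, hlintegral S hS hSν]
    refine ENNReal.ofReal_le_ofReal ?_
    have h := integral_mono_ae hintT ((hcostint S hS hSν).sub (hΨSint S hS hSν)) (hpoint S hS hSν)
    simp only [Pi.sub_apply] at h
    rw [hreduced _ hT hTν, hreduced S hS hSν] at h
    linarith
  · intro S hS hSν hopt
    have hle := hopt _ hT hTν
    rw [hlintegral _ hT hTν, hlintegral S hS hSν, ENNReal.ofReal_le_ofReal_iff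
      (integral_nonneg fun x => Real.rpow_nonneg (norm_nonneg _) _)] at hle
    have hintS := (hcostint S hS hSν).sub (hΨSint S hS hSν)
    have hge := integral_mono_ae hintT hintS (hpoint S hS hSν)
    have heq := (integral_eq_iff_of_ae_le hintT hintS (hpoint S hS hSν)).1 <|
      hge.antisymm <| by
        simp only [Pi.sub_apply]
        rw [hreduced _ hT hTν, hreduced S hS hSν]
        linarith
    filter_upwards [heq, hrange S hS hSν, hτuniq] with x hx ⟨j, hj⟩ huniq
    simp only [Pi.sub_apply] at hx
    rw [hj, hΨy, hΨy] at hx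
    rw [hj, huniq j hx.symm]
end
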